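/- Let c1, c2, c3, c4 be generic real numbers, N ≥ 0 an integer, and c0 = −2N−3−c1−c2−c3−c4. For all integers i, j, x, y ≥ 0 with i+j ≤ N and x+y ≤ N, the Tratnik polynomials of Racah type satisfy the three-term recurrence relation λ(x; c_{12}) · T_{i,j}(x,y) = C_{i+1}(c1,c2,c3; N−j) · T_{i+1,j}(x,y) − Σ_i(c1,c2,c3; N−j) · T_{i,j}(x,y) + A_{i−1}(c1,c2,c3; N−j) · T_{i−1,j}(x,y). -/

import Mathlib

open Finset

noncomputable section

/-- Pochhammer symbol `(a)_k = a (a+1) ⋯ (a+k-1)`. -/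
def poch (a : ℝ) (k : ℕ) : ℝ := ∏ i ∈ Finset.range k, (a + i)

/-- A real number is *generic* if it is not an integer. -/
def Generic (r : ℝ) : Prop := ∀ m : ℤ, r ≠ (m : ℝ)

/-- Genericity for three parameters: none of the parameters, nor any sum of two or three
of them, is an integer; this guarantees that no denominator vanishes. -/
def Generic3 (c1 c2 c3 : ℝ) : Prop :=
  Generic c1 ∧ Generic c2 ∧ Generic c3 ∧
  Generic (c1+c2) ∧ Generic (c1+c3) ∧ Generic (c2+c3) ∧
  Generic (c1+c2+c3)

/-- Genericity for four parameters: none of the parameters, nor any sum of two, three or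
four of them, is an integer; this guarantees that no denominator vanishes. -/
def Generic4 (c1 c2 c3 c4 : ℝ) : Prop :=
  Generic c1 ∧ Generic c2 ∧ Generic c3 ∧ Generic c4 ∧
  Generic (c1+c2) ∧ Generic (c1+c3) ∧ Generic (c1+c4) ∧
  Generic (c2+c3) ∧ Generic (c2+c4) ∧ Generic (c3+c4) ∧
  Generic (c1+c2+c3) ∧ Generic (c1+c2+c4) ∧ Generic (c1+c3+c4) ∧ Generic (c2+c3+c4) ∧
  Generic (c1+c2+c3+c4)

/-- Normalization `Ω(n; c1,c2,c3; M)`. -/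
def Om (n : ℤ) (c1 c2 c3 : ℝ) (M : ℤ) : ℝ :=
  (M.toNat.choose n.toNat : ℝ) * (2*(n:ℝ) + c2 + c3 + 1) *
    poch (c2+1) n.toNat * poch ((M:ℝ)+2+c1+c2+c3) n.toNat * poch (c1+1) (M-n).toNat /
    (poch (c3+1) n.toNat * poch (c2+c3+(n:ℝ)+1) (M.toNat+1))

/-- The renormalized Racah polynomial `p_n(x; c1,c2,c3; M)`, with the convention that it
vanishes unless `0 ≤ n ≤ M`. -/
def racah (n : ℤ) (x : ℝ) (c1 c2 c3 : ℝ) (M : ℤ) : ℝ :=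
  if 0 ≤ n ∧ n ≤ M then
    Om n c1 c2 c3 M *
      ∑ k ∈ Finset.range (n.toNat + 1),
        (poch (-(n:ℝ)) k * poch ((n:ℝ)+c2+c3+1) k * poch (-x) k * poch (x+c1+c2+1) k) /
        (poch (c2+1) k * poch ((M:ℝ)+2+c1+c2+c3) k * poch (-(M:ℝ)) k * (Nat.factorial k : ℝ))
  else 0

/-- Weight `Λ(x; c1,c2; M)`. -/
def Lam (x : ℤ) (c1 c2 : ℝ) (M : ℤ) : ℝ :=
  (-1:ℝ)^x.toNat * (M.toNat.choose x.toNat : ℝ) * (2*(x:ℝ)+c1+c2+1) * poch (c2+1) x.toNat /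
    (poch (c1+1) x.toNat * poch ((x:ℝ)+c1+c2+1) (M.toNat+1))

/-- `λ(x; c) = x(x+c+1)`. -/
def lam (x c : ℝ) : ℝ := x*(x+c+1)

/-- `μ_n(c) = n(n+c+1)`. -/
def mu (n c : ℝ) : ℝ := n*(n+c+1)

/-- Recurrence coefficient `A_n(c1,c2,c3; M)`. -/
def coefA (n c1 c2 c3 M : ℝ) : ℝ :=
  (n-M)*(n+c1+c2+c3+M+2)*(n+c2+1)*(n+c2+c3+1)/((2*n+c2+c3+1)*(2*n+c2+c3+2))

/-- Recurrence coefficient `C_n(c1,c2,c3; M)`. -/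
def coefC (n c1 c2 c3 M : ℝ) : ℝ :=
  n*(n-c1-M-1)*(n+c2+c3+M+1)*(n+c3)/((2*n+c2+c3)*(2*n+c2+c3+1))

/-- `Σ_n = A_n + C_n`. -/
def coefSig (n c1 c2 c3 M : ℝ) : ℝ := coefA n c1 c2 c3 M + coefC n c1 c2 c3 M

/-- Difference coefficient `B(x; c1,c2,c3; M)`. -/
def coefB (x c1 c2 c3 M : ℝ) : ℝ :=
  (x-M)*(x+c2+1)*(x+c1+c2+c3+M+2)*(x+c1+c2+1)/((2*x+c1+c2+1)*(2*x+c1+c2+2))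

/-- Difference coefficient `D(x; c1,c2,c3; M)`. -/
def coefD (x c1 c2 c3 M : ℝ) : ℝ :=
  x*(x+c1)*(x-c3-M-1)*(x+c1+c2+M+1)/((2*x+c1+c2)*(2*x+c1+c2+1))

/-- `S = B + D`. -/
def coefS (x c1 c2 c3 M : ℝ) : ℝ := coefB x c1 c2 c3 M + coefD x c1 c2 c3 M

/-- `F(x; c1,c2)`. -/
def Ffun (x c1 c2 : ℝ) : ℝ :=
  (x+c2+1)*(x+c1+c2+1)/((2*x+c1+c2+1)*(2*x+c1+c2+2))

/-- `λ⁺(x; c12; M) = (x+c12+M+2)(x−M−1)`. -/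
def lamP (x c12 M : ℝ) : ℝ := (x+c12+M+2)*(x-M-1)

/-- `A⁺_n(c2,c3; M)`. -/
def Ap (n c2 c3 M : ℝ) : ℝ := -(n-M-1)*(n-M)*Ffun n c3 c2

/-- `C⁺_n(c2,c3; M) = A⁺_{−n−c23−1}(c2,c3; M)`. -/
def Cp (n c2 c3 M : ℝ) : ℝ := Ap (-n-c2-c3-1) c2 c3 M

/-- `Σ⁺_n = A⁺_n + C⁺_n + (M+1)(M+1+c3)`. -/
def Sp (n c2 c3 M : ℝ) : ℝ := Ap n c2 c3 M + Cp n c2 c3 M + (M+1)*(M+1+c3)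

/-- `λ⁻(x; c123, c3; M) = (x+c123+M+1)(x−M−c3)`. -/
def lamM (x c123 c3 M : ℝ) : ℝ := (x+c123+M+1)*(x-M-c3)

/-- `A⁻_n(c1,c2,c3; M)`. -/
def Am (n c1 c2 c3 M : ℝ) : ℝ := -(n+c1+c2+c3+M+1)*(n+c1+c2+c3+M+2)*Ffun n c3 c2

/-- `C⁻_n(c1,c2,c3; M) = A⁻_{−n−c23−1}(c1,c2,c3; M)`. -/
def Cm (n c1 c2 c3 M : ℝ) : ℝ := Am (-n-c2-c3-1) c1 c2 c3 M

/-- `Σ⁻_n = A⁻_n + C⁻_n + (M+c12+1)(M+c123+1)`. -/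
def Sm (n c1 c2 c3 M : ℝ) : ℝ :=
  Am n c1 c2 c3 M + Cm n c1 c2 c3 M + (M+c1+c2+1)*(M+c1+c2+c3+1)

/-- `μ⁺_n(c123, c1; M) = (n+c123+M+2)(n−M−1−c1)`. -/
def muP (n c123 c1 M : ℝ) : ℝ := (n+c123+M+2)*(n-M-1-c1)

/-- `B⁺(x; c1,c2,c3; M)`. -/
def Bp (x c1 c2 c3 M : ℝ) : ℝ := -(x+c1+c2+c3+M+2)*(x+c1+c2+c3+M+3)*Ffun x c1 c2

/-- `D⁺(x; c1,c2,c3; M) = B⁺(−x−c12−1; c1,c2,c3; M)`. -/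
def Dp (x c1 c2 c3 M : ℝ) : ℝ := Bp (-x-c1-c2-1) c1 c2 c3 M

/-- `S⁺ = B⁺ + D⁺ + (c23+M+2)(c123+M+2)`. -/
def SpD (x c1 c2 c3 M : ℝ) : ℝ :=
  Bp x c1 c2 c3 M + Dp x c1 c2 c3 M + (c2+c3+M+2)*(c1+c2+c3+M+2)

/-- `μ⁻_n(c23; M) = (n−M)(n+c23+M+1)`. -/
def muM (n c23 M : ℝ) : ℝ := (n-M)*(n+c23+M+1)

/-- `B⁻(x; c1,c2; M)`. -/
def Bm (x c1 c2 M : ℝ) : ℝ := -(x-M)*(x-M+1)*Ffun x c1 c2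

/-- `D⁻(x; c1,c2; M) = B⁻(−x−c12−1; c1,c2; M)`. -/
def Dm (x c1 c2 M : ℝ) : ℝ := Bm (-x-c1-c2-1) c1 c2 M

/-- `S⁻ = B⁻ + D⁻ + M(c1+M)`. -/
def SmD (x c1 c2 M : ℝ) : ℝ := Bm x c1 c2 M + Dm x c1 c2 M + M*(c1+M)

/-- Nine-point recurrence coefficients `A^{e,e'}_{i,j}(c1,c2,c3,c4)` (with
`c0 = −2N−3−c1−c2−c3−c4`). -/
def nineA (e e' : ℤ) (i j : ℝ) (c1 c2 c3 c4 N : ℝ) : ℝ :=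
  let c0 : ℝ := -2*N-3-c1-c2-c3-c4
  if e = 1 ∧ e' = 1 then -(Ffun (-j-c0-c4-1) c4 c0) * Cm i c1 c2 c3 (N-j+1)
  else if e = 0 ∧ e' = 1 then (Ffun (-j-c0-c4-1) c4 c0) * Sm i c1 c2 c3 (N-j+1)
  else if e = -1 ∧ e' = 1 then -(Ffun (-j-c0-c4-1) c4 c0) * Am i c1 c2 c3 (N-j+1)
  else if e = 1 ∧ e' = -1 then -(Ffun j c4 c0) * Cp i c2 c3 (N-j-1)
  else if e = 0 ∧ e' = -1 then (Ffun j c4 c0) * Sp i c2 c3 (N-j-1)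
  else if e = -1 ∧ e' = -1 then -(Ffun j c4 c0) * Ap i c2 c3 (N-j-1)
  else if e = 1 ∧ e' = 0 then (Ffun j c4 c0 + Ffun (-j-c0-c4-1) c4 c0) * coefC i c1 c2 c3 (N-j)
  else if e = 0 ∧ e' = 0 then
    -(Ffun j c4 c0 + Ffun (-j-c0-c4-1) c4 c0) *
      (coefSig i c1 c2 c3 (N-j) + (N-j)^2 + (c1+c2+c3+2)*(N-j) + (1/2)*(c3+1)*(c1+c2+c3+1))
  else if e = -1 ∧ e' = 0 then (Ffun j c4 c0 + Ffun (-j-c0-c4-1) c4 c0) * coefA i c1 c2 c3 (N-j)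
  else 0

/-- `Γ^{0,0}_{i,j}(c1,c2,c3,c4)`. -/
def gam00 (i j : ℝ) (c1 c2 c3 c4 N : ℝ) : ℝ :=
  let c0 : ℝ := -2*N-3-c1-c2-c3-c4
  (-(coefSig i c1 c2 c3 (N-j)) + coefSig j c1 c0 c4 (N-i) - (1/4)*(c3^2-c4^2)
    + (i-N-(1/2)*(c4+1))*(i+(1/2)*(c2+c3-c0-c1))
    - (j-N-(1/2)*(c3+1))*(j+(1/2)*(c0+c4-c1-c2)))

/-- `Γ^{e,e'}_{i,j}` coefficients. -/
def gam (e e' : ℤ) (i j : ℝ) (c1 c2 c3 c4 N : ℝ) : ℝ :=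
  let c0 : ℝ := -2*N-3-c1-c2-c3-c4
  if e = 0 ∧ e' = 1 then coefC j c1 c0 c4 (N-i)
  else if e = 0 ∧ e' = -1 then coefA j c1 c0 c4 (N-i)
  else if e = 1 ∧ e' = 0 then coefC i c1 c2 c3 (N-j)
  else if e = -1 ∧ e' = 0 then coefA i c1 c2 c3 (N-j)
  else if e = 0 ∧ e' = 0 then gam00 i j c1 c2 c3 c4 N
  else 0

/-- Nine-point difference coefficients `D^{e,e'}(x,y; c1,c2,c3,c4)` (with
`c0 = −2N−3−c1−c2−c3−c4`). -/
def nineD (e e' : ℤ) (x y : ℝ) (c1 c2 c3 c4 N : ℝ) : ℝ :=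
  let c0 : ℝ := -2*N-3-c1-c2-c3-c4
  if e = 1 ∧ e' = 1 then -(Ffun x c1 c2) * Bm y c3 c0 (N-x)
  else if e = 1 ∧ e' = 0 then (Ffun x c1 c2) * SmD y c3 c0 (N-x)
  else if e = 1 ∧ e' = -1 then -(Ffun x c1 c2) * Dm y c3 c0 (N-x)
  else if e = -1 ∧ e' = 1 then -(Ffun (-x-c1-c2-1) c1 c2) * Bp y c3 c0 c4 (N-x)
  else if e = -1 ∧ e' = 0 then (Ffun (-x-c1-c2-1) c1 c2) * SpD y c3 c0 c4 (N-x)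
  else if e = -1 ∧ e' = -1 then -(Ffun (-x-c1-c2-1) c1 c2) * Dp y c3 c0 c4 (N-x)
  else if e = 0 ∧ e' = 1 then (Ffun x c1 c2 + Ffun (-x-c1-c2-1) c1 c2) * coefB y c3 c0 c4 (N-x)
  else if e = 0 ∧ e' = 0 then
    -(Ffun x c1 c2 + Ffun (-x-c1-c2-1) c1 c2) *
      (coefS y c3 c0 c4 (N-x) + (N-x)^2 + (c0+c3+c4+2)*(N-x) + (1/2)*(c3+1)*(c0+c3+c4+1))
  else if e = 0 ∧ e' = -1 then (Ffun x c1 c2 + Ffun (-x-c1-c2-1) c1 c2) * coefD y c3 c0 c4 (N-x)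
  else 0

/-- `Ψ^{a,b}(x,y)` coefficients: the first superscript refers to the shift in `y`,
the second to the shift in `x` (with `c0 = −2N−3−c1−c2−c3−c4`). -/
def psi (a b : ℤ) (x y : ℝ) (c1 c2 c3 c4 N : ℝ) : ℝ :=
  let c0 : ℝ := -2*N-3-c1-c2-c3-c4
  if a = 0 ∧ b = 1 then coefB x c4 c2 c1 (N-y)
  else if a = 0 ∧ b = -1 then coefD x c4 c2 c1 (N-y)
  else if a = 1 ∧ b = 0 then coefB y c3 c0 c1 (N-x)
  else if a = -1 ∧ b = 0 then coefD y c3 c0 c1 (N-x)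
  else if a = 0 ∧ b = 0 then gam00 x y c1 c2 c4 c3 N
  else 0

/-- Tratnik polynomial of Racah type `T_{i,j}(x,y; c1,c2,c3,c4; N)`, set to `0` outside
the triangular domains. -/
def trat (c1 c2 c3 c4 : ℝ) (Nn : ℕ) (i j x y : ℤ) : ℝ :=
  let c0 : ℝ := -2*(Nn:ℝ)-3-c1-c2-c3-c4
  if 0 ≤ i ∧ 0 ≤ j ∧ i + j ≤ (Nn:ℤ) ∧ 0 ≤ x ∧ 0 ≤ y ∧ x + y ≤ (Nn:ℤ) then
    racah i (x:ℝ) c1 c2 c3 ((Nn:ℤ)-j) * racah j (y:ℝ) c3 c0 c4 ((Nn:ℤ)-x)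
  else 0

/-- Griffiths polynomial of Racah type `G_{i,j}(x,y; c1,c2,c3,c4; N)`, set to `0` outside
the triangular domains. -/
def grif (c1 c2 c3 c4 : ℝ) (Nn : ℕ) (i j x y : ℤ) : ℝ :=
  let c0 : ℝ := -2*(Nn:ℝ)-3-c1-c2-c3-c4
  if 0 ≤ i ∧ 0 ≤ j ∧ i + j ≤ (Nn:ℤ) ∧ 0 ≤ x ∧ 0 ≤ y ∧ x + y ≤ (Nn:ℤ) then
    ∑ a ∈ Finset.range (((Nn:ℤ)-j).toNat + 1),
      (-1:ℝ)^a * racah i (a:ℝ) c1 c2 c3 ((Nn:ℤ)-j) * racah j (y:ℝ) c3 c0 c4 ((Nn:ℤ)-(a:ℤ)) *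
        racah (a:ℤ) (x:ℝ) c4 c2 c1 ((Nn:ℤ)-y)
  else 0

/-- Krawtchouk polynomial `K_n(x; p; M)`, set to `0` unless `0 ≤ n ≤ M`. -/
def kraw (n : ℤ) (x : ℝ) (p : ℝ) (M : ℤ) : ℝ :=
  if 0 ≤ n ∧ n ≤ M then
    (M.toNat.choose n.toNat : ℝ) * (p/(1-p))^n.toNat *
      ∑ k ∈ Finset.range (n.toNat + 1),
        poch (-(n:ℝ)) k * poch (-x) k / (poch (-(M:ℝ)) k * (Nat.factorial k : ℝ)) * (1/p)^k
  else 0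

lemma poch_succ (a : ℝ) (k : ℕ) : poch a (k+1) = poch a k * (a + k) :=
  Finset.prod_range_succ _ _

lemma poch_succ_left (a : ℝ) (k : ℕ) : poch a (k+1) = a * poch (a+1) k := by
  unfold poch
  rw [Finset.prod_range_succ', mul_comm]
  congr 1
  · simp
  · refine Finset.prod_congr rfl fun i _ => ?_
    push_cast
    ring

lemma poch_ne_zero {a : ℝ} {k : ℕ} (h : ∀ i < k, a + i ≠ 0) : poch a k ≠ 0 :=
  Finset.prod_ne_zero_iff.mpr fun i hi => h i (Finset.mem_range.mp hi)

lemma poch_neg_natCast_eq_zero {m k : ℕ} (h : m < k) : poch (-(m:ℝ)) k = 0 :=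
  Finset.prod_eq_zero (Finset.mem_range.mpr h) (by ring)

lemma Generic.add_intCast_ne_zero {r : ℝ} (h : Generic r) (m : ℤ) : r + m ≠ 0 := by
  intro hr
  apply h (-m)
  push_cast
  linarith

lemma Generic.poch_add_intCast_ne_zero {r : ℝ} (h : Generic r) (m : ℤ) (k : ℕ) :
    poch (r + m) k ≠ 0 := by
  refine poch_ne_zero fun i _ => ?_
  have := h.add_intCast_ne_zero (m + i)
  push_cast at this
  rwa [add_assoc]

/-- The `k`-th summand of the hypergeometric series defining the Racah polynomial. -/
def racahTerm (c1 c2 c3 M n x : ℝ) (k : ℕ) : ℝ :=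
  (poch (-n) k * poch (n+c2+c3+1) k * poch (-x) k * poch (x+c1+c2+1) k) /
    (poch (c2+1) k * poch (M+2+c1+c2+c3) k * poch (-M) k * (Nat.factorial k : ℝ))

/-- Action of the recurrence operator in the degree on the products `(-n)_k (n+c₂+c₃+1)_k`. -/
lemma coefA_coefC_poch (c1 c2 c3 M n : ℝ) (k : ℕ)
    (h0 : 2*n+c2+c3 ≠ 0) (h1 : 2*n+c2+c3+1 ≠ 0) (h2 : 2*n+c2+c3+2 ≠ 0) :
    coefA n c1 c2 c3 M * (poch (-(n+1)) (k+1) * poch (n+1+c2+c3+1) (k+1))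
      - coefSig n c1 c2 c3 M * (poch (-n) (k+1) * poch (n+c2+c3+1) (k+1))
      + coefC n c1 c2 c3 M * (poch (-(n-1)) (k+1) * poch (n-1+c2+c3+1) (k+1)) =
    (k+1)*(k+c1+c2+2) * (poch (-n) (k+1) * poch (n+c2+c3+1) (k+1))
      - (c2+1+k)*(M+2+c1+c2+c3+k)*(-M+k)*(k+1) * (poch (-n) k * poch (n+c2+c3+1) k) := by
  have e1 : poch (-(n+1)) (k+1) = -(n+1) * poch (-n) k := by
    rw [poch_succ_left]; ring_nf
  have e2 : poch (n+1+c2+c3+1) (k+1) = poch (n+c2+c3+2) k * (n+c2+c3+2+k) := by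
    rw [poch_succ]; ring_nf
  have e3 : (n+c2+c3+1) * poch (n+c2+c3+2) k = poch (n+c2+c3+1) k * (n+c2+c3+1+k) := by
    rw [← poch_succ, poch_succ_left]; ring_nf
  have e4 : poch (-(n-1)) (k+1) = poch (1-n) k * (1-n+k) := by
    rw [poch_succ]; ring_nf
  have e5 : poch (n-1+c2+c3+1) (k+1) = (n+c2+c3) * poch (n+c2+c3+1) k := by
    rw [poch_succ_left]; ring_nf
  have e6 : -n * poch (1-n) k = poch (-n) k * (-n+k) := by
    rw [← poch_succ, poch_succ_left]; ring_nf
  have hA : coefA n c1 c2 c3 M * (poch (-(n+1)) (k+1) * poch (n+1+c2+c3+1) (k+1)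
        - poch (-n) (k+1) * poch (n+c2+c3+1) (k+1)) =
      -(k+1) * (n-M)*(n+c1+c2+c3+M+2)*(n+c2+1)*(n+c2+c3+1+k)/(2*n+c2+c3+1)
        * (poch (-n) k * poch (n+c2+c3+1) k) := by
    rw [e1, e2, poch_succ (-n), poch_succ_left (n+c2+c3+1),
      show n+c2+c3+1+1 = n+c2+c3+2 by ring]
    clear e1 e2 e4 e5 e6
    unfold coefA
    generalize poch (n+c2+c3+2) k = q at *
    generalize poch (n+c2+c3+1) k = q' at *
    generalize hd : 2*n+c2+c3 = d at *
    field_simp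
    subst hd
    linear_combination (-(k+1) * (n-M)*(n+c1+c2+c3+M+2)*(n+c2+1) * poch (-n) k
      * (2*n+c2+c3+2)) * e3
  have hC : coefC n c1 c2 c3 M * (poch (-n) (k+1) * poch (n+c2+c3+1) (k+1)
        - poch (-(n-1)) (k+1) * poch (n-1+c2+c3+1) (k+1)) =
      (k+1) * (n-c1-M-1)*(n+c2+c3+M+1)*(n+c3)*(-n+k)/(2*n+c2+c3+1)
        * (poch (-n) k * poch (n+c2+c3+1) k) := by
    rw [e4, e5, poch_succ (n+c2+c3+1), poch_succ (-n), ← e6]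
    clear e1 e2 e3 e4 e5 hA
    unfold coefC
    rw [div_mul_eq_mul_div, div_mul_eq_mul_div, div_eq_div_iff (mul_ne_zero h0 h1) h1]
    linear_combination ((k+1) * (n-c1-M-1)*(n+c2+c3+M+1)*(n+c3) * poch (n+c2+c3+1) k
      * ((2*n+c2+c3)*(2*n+c2+c3+1))) * e6
  have hS : coefA n c1 c2 c3 M * (poch (-(n+1)) (k+1) * poch (n+1+c2+c3+1) (k+1))
      - coefSig n c1 c2 c3 M * (poch (-n) (k+1) * poch (n+c2+c3+1) (k+1))
      + coefC n c1 c2 c3 M * (poch (-(n-1)) (k+1) * poch (n-1+c2+c3+1) (k+1)) =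
      coefA n c1 c2 c3 M * (poch (-(n+1)) (k+1) * poch (n+1+c2+c3+1) (k+1)
        - poch (-n) (k+1) * poch (n+c2+c3+1) (k+1))
      - coefC n c1 c2 c3 M * (poch (-n) (k+1) * poch (n+c2+c3+1) (k+1)
        - poch (-(n-1)) (k+1) * poch (n-1+c2+c3+1) (k+1)) := by
    unfold coefSig
    ring
  rw [hS, hA, hC, poch_succ, poch_succ]
  clear hS hA hC e1 e2 e3 e4 e5 e6
  generalize hd : 2*n+c2+c3 = d at *
  field_simp
  subst hd
  ring

/-- Partial sums of the three-term recurrence telescope. -/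
lemma racahTerm_recurrence_partial (c1 c2 c3 M n x : ℝ) (K : ℕ)
    (h0 : 2*n+c2+c3 ≠ 0) (h1 : 2*n+c2+c3+1 ≠ 0) (h2 : 2*n+c2+c3+2 ≠ 0)
    (hc2 : ∀ k < K, c2+1+(k:ℝ) ≠ 0) (hc : ∀ k < K, M+2+c1+c2+c3+(k:ℝ) ≠ 0)
    (hM : ∀ k < K, -M+(k:ℝ) ≠ 0) :
    ∑ k ∈ range (K+1), (coefA n c1 c2 c3 M * racahTerm c1 c2 c3 M (n+1) x k
      - coefSig n c1 c2 c3 M * racahTerm c1 c2 c3 M n x k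
      + coefC n c1 c2 c3 M * racahTerm c1 c2 c3 M (n-1) x k
      - lam x (c1+c2) * racahTerm c1 c2 c3 M n x k) =
    racahTerm c1 c2 c3 M n x K * ((-x+K)*(x+c1+c2+1+K)) := by
  induction K with
  | zero =>
    simp only [zero_add, Finset.sum_range_one, racahTerm, poch, coefSig, lam,
      Finset.prod_range_zero, Nat.factorial_zero]
    push_cast
    ring
  | succ K ih =>
    rw [Finset.sum_range_succ, ih (fun k hk => hc2 k (by omega)) (fun k hk => hc k (by omega))
      (fun k hk => hM k (by omega))]
    have key := coefA_coefC_poch c1 c2 c3 M n K h0 h1 h2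
    have a1 := hc2 K (by omega)
    have a2 := hc K (by omega)
    have a3 := hM K (by omega)
    have p1 : poch (c2+1) K ≠ 0 := poch_ne_zero fun k hk => hc2 k (by omega)
    have p2 : poch (M+2+c1+c2+c3) K ≠ 0 := poch_ne_zero fun k hk => hc k (by omega)
    have p3 : poch (-M) K ≠ 0 := poch_ne_zero fun k hk => hM k (by omega)
    have p4 : (Nat.factorial K : ℝ) ≠ 0 := by positivity
    have a4 : (K:ℝ) + 1 ≠ 0 := by positivity
    have hw : (poch (c2+1) K * poch (M+2+c1+c2+c3) K * poch (-M) K * (Nat.factorial K : ℝ))⁻¹ =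
        (poch (c2+1) (K+1) * poch (M+2+c1+c2+c3) (K+1) * poch (-M) (K+1)
          * (Nat.factorial (K+1) : ℝ))⁻¹
        * ((c2+1+K)*(M+2+c1+c2+c3+K)*(-M+K)*(K+1)) := by
      rw [poch_succ (c2+1), poch_succ (M+2+c1+c2+c3), poch_succ (-M), Nat.factorial_succ]
      push_cast
      clear key ih
      field_simp
    simp only [racahTerm, lam, div_eq_mul_inv, hw]
    rw [poch_succ (-x), poch_succ (x+c1+c2+1)]
    push_cast
    linear_combination (poch (-x) K * (-x+K) * (poch (x+c1+c2+1) K * (x+c1+c2+1+K))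
      * (poch (c2+1) (K+1) * poch (M+2+c1+c2+c3) (K+1) * poch (-M) (K+1)
          * (Nat.factorial (K+1) : ℝ))⁻¹) * key

lemma racah_eq_sum_racahTerm (c1 c2 c3 : ℝ) (n M : ℕ) (x : ℝ) (h : n ≤ M) :
    racah n x c1 c2 c3 M =
      Om n c1 c2 c3 M * ∑ k ∈ range (M+1), racahTerm c1 c2 c3 M n x k := by
  rw [racah, if_pos ⟨by positivity, by exact_mod_cast h⟩]
  congr 1
  simp only [Int.toNat_natCast, Int.cast_natCast]
  refine Finset.sum_subset (Finset.range_mono (by omega)) fun k _ hk => ?_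
  rw [poch_neg_natCast_eq_zero (by simpa using hk)]
  simp

/-- On the grid `0, …, M`, the hypergeometric sums satisfy the three-term recurrence. -/
lemma sum_racahTerm_recurrence (c1 c2 c3 : ℝ) (h2 : Generic c2) (h23 : Generic (c2+c3))
    (h123 : Generic (c1+c2+c3)) (n x M : ℕ) (hx : x ≤ M) :
    lam x (c1+c2) * ∑ k ∈ range (M+1), racahTerm c1 c2 c3 M n x k =
      coefA n c1 c2 c3 M * ∑ k ∈ range (M+1), racahTerm c1 c2 c3 M (n+1) x k
      - coefSig n c1 c2 c3 M * ∑ k ∈ range (M+1), racahTerm c1 c2 c3 M n x k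
      + coefC n c1 c2 c3 M * ∑ k ∈ range (M+1), racahTerm c1 c2 c3 M (n-1) x k := by
  have H := racahTerm_recurrence_partial c1 c2 c3 M n x M
    (by convert h23.add_intCast_ne_zero (2*n) using 1; push_cast; ring)
    (by convert h23.add_intCast_ne_zero (2*n+1) using 1; push_cast; ring)
    (by convert h23.add_intCast_ne_zero (2*n+2) using 1; push_cast; ring)
    (fun k _ => by convert h2.add_intCast_ne_zero (1+k) using 1; push_cast; ring)
    (fun k _ => by convert h123.add_intCast_ne_zero (M+2+k) using 1; push_cast; ring)
    (fun k hk => by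
      have : (k:ℝ) < M := by exact_mod_cast hk
      linarith)
  have hz : racahTerm c1 c2 c3 M n x M * ((-(x:ℝ)+M)*(x+c1+c2+1+M)) = 0 := by
    rcases hx.lt_or_eq with h | rfl
    · simp [racahTerm, poch_neg_natCast_eq_zero h]
    · simp
  rw [hz] at H
  simp only [Finset.sum_add_distrib, Finset.sum_sub_distrib, ← Finset.mul_sum] at H
  linarith

/-- The normalization exchanges the roles of `A` and `C`. -/
lemma coefC_mul_Om_succ (c1 c2 c3 : ℝ) (h3 : Generic c3)
    (h23 : Generic (c2+c3)) (n M : ℕ) (h : n < M) :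
    coefC (n+1) c1 c2 c3 M * Om (n+1) c1 c2 c3 M = coefA n c1 c2 c3 M * Om n c1 c2 c3 M := by
  have hch : (M.choose (n+1) : ℝ) * (n+1) = M.choose n * (M - n) := by
    rw [← Nat.cast_sub h.le]
    exact_mod_cast Nat.choose_succ_right_eq M n
  have hp1 : poch (c1+1) (M-n) = poch (c1+1) (M-(n+1)) * (c1 + M - n) := by
    rw [show M - n = (M-(n+1)) + 1 by omega, poch_succ, Nat.cast_sub h]
    push_cast
    ring
  have hp23 : poch (c2+c3+n+1) (M+1) * (c2+c3+n+M+2) =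
      (c2+c3+n+1) * poch (c2+c3+(n+1)+1) (M+1) := by
    rw [show c2+c3+n+M+2 = c2+c3+n+1+((M+1:ℕ):ℝ) by push_cast; ring, ← poch_succ,
      poch_succ_left]
    ring_nf
  have n1 : c3+1+(n:ℝ) ≠ 0 := by
    convert h3.add_intCast_ne_zero (1+n) using 1; push_cast; ring
  have n2 : poch (c3+1) n ≠ 0 := by exact_mod_cast h3.poch_add_intCast_ne_zero 1 n
  have n3 : poch (c2+c3+n+1) (M+1) ≠ 0 := by
    have := h23.poch_add_intCast_ne_zero (n+1) (M+1)
    push_cast at this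
    rwa [← add_assoc] at this
  have n4 : poch (c2+c3+(n+1)+1) (M+1) ≠ 0 := by
    have := h23.poch_add_intCast_ne_zero (n+1+1) (M+1)
    push_cast at this
    rwa [← add_assoc] at this
  have d1 : 2*(n:ℝ)+c2+c3+1 ≠ 0 := by
    convert h23.add_intCast_ne_zero (2*n+1) using 1; push_cast; ring
  have d2 : 2*(n:ℝ)+c2+c3+2 ≠ 0 := by
    convert h23.add_intCast_ne_zero (2*n+2) using 1; push_cast; ring
  have d3 : 2*(n:ℝ)+c2+c3+3 ≠ 0 := by
    convert h23.add_intCast_ne_zero (2*n+3) using 1; push_cast; ring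
  have t1 : ((n:ℤ)+1).toNat = n+1 := by omega
  have t2 : ((M:ℤ)-n).toNat = M-n := by omega
  have t3 : ((M:ℤ)-(n+1)).toNat = M-(n+1) := by omega
  unfold Om coefA coefC
  rw [t1, t2, t3, hp1, poch_succ (c2+1), poch_succ (c3+1), poch_succ ((M:ℤ)+2+c1+c2+c3)]
  push_cast
  simp only [Int.toNat_natCast]
  rw [show 2*((n:ℝ)+1)+c2+c3 = 2*n+c2+c3+2 by ring,
    show 2*(n:ℝ)+c2+c3+2+1 = 2*n+c2+c3+3 by ring]
  generalize poch (c1+1) (M-(n+1)) = P1 at *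
  generalize poch (c2+c3+(n+1)+1) (M+1) = P2 at *
  generalize poch (c2+c3+n+1) (M+1) = P3 at *
  generalize poch (c2+1) n = P4 at *
  generalize poch (c3+1) n = P5 at *
  generalize poch (M+2+c1+c2+c3) n = P6 at *
  have d4 : c2+c3+(n:ℝ)+1 ≠ 0 := by
    convert h23.add_intCast_ne_zero (n+1) using 1; push_cast; ring
  have d5 : (n:ℝ)+1 ≠ 0 := by positivity
  rw [← eq_div_iff d5] at hch
  rw [mul_comm (c2+c3+n+1), ← div_eq_iff d4] at hp23
  rw [hch, ← hp23]
  have d6 : c2+c3+(n:ℝ)+M+2 ≠ 0 := by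
    convert h23.add_intCast_ne_zero (n+M+2) using 1; push_cast; ring
  clear hch hp23 hp1 n4
  generalize hd : 2*(n:ℝ)+c2+c3 = d at *
  field_simp
  ring

/-- Three-term recurrence of the renormalized Racah polynomials on the grid `0, …, M`. -/
lemma racah_recurrence (c1 c2 c3 : ℝ) (h : Generic3 c1 c2 c3) (n x M : ℕ) (hn : n ≤ M)
    (hx : x ≤ M) :
    lam x (c1+c2) * racah n x c1 c2 c3 M =
      coefC (n+1) c1 c2 c3 M * racah (n+1) x c1 c2 c3 M
      - coefSig n c1 c2 c3 M * racah n x c1 c2 c3 M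
      + coefA (n-1) c1 c2 c3 M * racah (n-1) x c1 c2 c3 M := by
  obtain ⟨-, h2, h3, -, -, h23, h123⟩ := h
  have H := sum_racahTerm_recurrence c1 c2 c3 h2 h23 h123 n x M hx
  have hC : coefC (n+1) c1 c2 c3 M * racah (n+1) x c1 c2 c3 M =
      coefA n c1 c2 c3 M * Om n c1 c2 c3 M *
        ∑ k ∈ range (M+1), racahTerm c1 c2 c3 M (n+1) x k := by
    rcases hn.lt_or_eq with hlt | rfl
    · have e := racah_eq_sum_racahTerm c1 c2 c3 (n+1) M x hlt
      push_cast at e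
      rw [e, ← mul_assoc, coefC_mul_Om_succ c1 c2 c3 h3 h23 n M hlt]
    · simp [racah, coefA]
  have hA : coefA (n-1) c1 c2 c3 M * racah (n-1) x c1 c2 c3 M =
      coefC n c1 c2 c3 M * Om n c1 c2 c3 M *
        ∑ k ∈ range (M+1), racahTerm c1 c2 c3 M (n-1) x k := by
    cases n with
    | zero => simp [racah, coefC]
    | succ m =>
      have e := racah_eq_sum_racahTerm c1 c2 c3 m M x (by omega)
      have o := coefC_mul_Om_succ c1 c2 c3 h3 h23 m M (by omega)
      push_cast
      rw [add_sub_cancel_right, add_sub_cancel_right, e, ← mul_assoc, o]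
  rw [hC, hA, racah_eq_sum_racahTerm c1 c2 c3 n M x hn]
  linear_combination Om n c1 c2 c3 M * H

/-- three-term recurrence relation in `x` for the Tratnik polynomials
of Racah type. -/
theorem tratnik_recurrence_x
    (Nn : ℕ) (c1 c2 c3 c4 : ℝ) (hgen : Generic4 c1 c2 c3 c4)
    (i j x y : ℤ) (hi : 0 ≤ i) (hj : 0 ≤ j) (hij : i + j ≤ (Nn:ℤ))
    (hx : 0 ≤ x) (hy : 0 ≤ y) (hxy : x + y ≤ (Nn:ℤ)) :
    lam (x:ℝ) (c1+c2) * trat c1 c2 c3 c4 Nn i j x y =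
      coefC ((i:ℝ)+1) c1 c2 c3 ((Nn:ℝ)-(j:ℝ)) * trat c1 c2 c3 c4 Nn (i+1) j x y
        - coefSig (i:ℝ) c1 c2 c3 ((Nn:ℝ)-(j:ℝ)) * trat c1 c2 c3 c4 Nn i j x y
        + coefA ((i:ℝ)-1) c1 c2 c3 ((Nn:ℝ)-(j:ℝ)) * trat c1 c2 c3 c4 Nn (i-1) j x y := by
  obtain ⟨g1, g2, g3, -, g12, g13, -, g23, -, -, g123, -, -, -, -⟩ := hgen
  lift i to ℕ using hi
  lift j to ℕ using hj
  lift x to ℕ using hx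
  obtain ⟨M, rfl⟩ : ∃ M : ℕ, Nn = j + M := ⟨Nn - j, by omega⟩
  have hM : ((j + M : ℕ) : ℤ) - j = M := by push_cast; ring
  have hMr : ((j + M : ℕ) : ℝ) - (j : ℤ) = M := by push_cast; ring
  by_cases hxM : x ≤ M
  · have htrat (m : ℤ) : trat c1 c2 c3 c4 (j+M) m j x y =
        racah m x c1 c2 c3 M * racah j y c3 (-2*((j+M:ℕ):ℝ)-3-c1-c2-c3-c4) c4
          (((j+M:ℕ):ℤ)-x) := by
      unfold trat
      simp only [hM, Int.cast_natCast]
      split_ifs with hd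
      · rfl
      · rw [racah, if_neg (by omega), zero_mul]
    have H := racah_recurrence c1 c2 c3 ⟨g1, g2, g3, g12, g13, g23, g123⟩ i x M (by omega) hxM
    rw [htrat, htrat, htrat, hMr]
    simp only [Int.cast_natCast]
    linear_combination racah j y c3 (-2*((j+M:ℕ):ℝ)-3-c1-c2-c3-c4) c4 (((j+M:ℕ):ℤ)-x) * H
  · have htrat (m : ℤ) : trat c1 c2 c3 c4 (j+M) m j x y = 0 := by
      unfold trat
      split_ifs with hd
      · simp only []
        rw [racah.eq_def j, if_neg (by omega), mul_zero]
      · rfl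
    simp [htrat]
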